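/- arXiv:2605.01958 — 2 statements merged into one kernel-verified Lean document; each statement's English description precedes it below -/
import Mathlib

section
/- Let −1 < a < 0 and let (x_{0,i}, w_i, x_i, ℓ_i)_{i=1,…,n} be a homogeneous reflected system with parameter a. Then for every i, every t ≥ 0 and every 0 ≤ δ ≤ t, w_t(ℓ_i, δ) ≤ w_t(w_i, δ) + 2|a|(1 − |a|)⁻¹ ⟨w_t(w, δ)⟩, where ⟨w_t(w, δ)⟩ = n⁻¹∑_{j=1}^n w_t(w_j, δ). -/
open MeasureTheory Set

noncomputable def nnegPart (r : ℝ) : ℝ := max (-r) 0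

open Classical in
noncomputable def lsMeasure (f : ℝ → ℝ) : Measure ℝ :=
  if h : Monotone f ∧ Continuous f then
    StieltjesFunction.measure
      { toFun := f, mono' := h.1, right_continuous' := fun _ => h.2.continuousWithinAt }
  else 0

def IsBoundaryTerm (x ℓ : ℝ → ℝ) : Prop :=
  Continuous ℓ ∧ Monotone ℓ ∧ (∀ s ≤ (0:ℝ), ℓ s = 0) ∧
    ∫⁻ s in Set.Ici (0:ℝ), ENNReal.ofReal (x s) ∂(lsMeasure ℓ) = 0

noncomputable def supNorm (f : ℝ → ℝ) (t : ℝ) : ℝ :=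
  sSup ((fun s => |f s|) '' Set.Icc 0 t)

noncomputable def modCont (f : ℝ → ℝ) (t δ : ℝ) : ℝ :=
  sSup ((fun p : ℝ × ℝ => |f p.1 - f p.2|) ''
    {p : ℝ × ℝ | p.1 ∈ Set.Icc 0 t ∧ p.2 ∈ Set.Icc 0 t ∧ |p.1 - p.2| ≤ δ})

noncomputable def penalty (ε : ℝ) (x : ℝ) : ℝ :=
  if x ≤ -ε then ε⁻¹ else if x < 0 then -(x / ε ^ 2) else 0

def HomogeneousSystem (n : ℕ) (a : ℝ) (x0 : Fin n → ℝ)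
    (w x ℓ : Fin n → ℝ → ℝ) : Prop :=
  (∀ i, 0 ≤ x0 i) ∧ (∀ i, Continuous (w i)) ∧ (∀ i, w i 0 = 0) ∧
  (∀ i, Continuous (x i)) ∧ (∀ i t, 0 ≤ t → 0 ≤ x i t) ∧
  (∀ i, IsBoundaryTerm (x i) (ℓ i)) ∧
  (∀ i t, 0 ≤ t → x i t = x0 i + w i t + ℓ i t +
      a * (((n : ℝ) - 1)⁻¹ * ∑ j ∈ Finset.univ.erase i, ℓ j t))

def CompletelyS {n : ℕ} (R : Matrix (Fin n) (Fin n) ℝ) : Prop :=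
  ∀ J : Finset (Fin n), J.Nonempty →
    ∃ x : Fin n → ℝ, (∀ j ∈ J, 0 ≤ x j) ∧ ∀ i ∈ J, 0 < ∑ j ∈ J, R i j * x j

lemma lsMeasure_Ioc {f : ℝ → ℝ} (hm : Monotone f) (hc : Continuous f) (p s : ℝ) :
    lsMeasure f (Ioc p s) = ENNReal.ofReal (f s - f p) := by
  rw [lsMeasure, dif_pos ⟨hm, hc⟩, StieltjesFunction.measure_Ioc]

/-- Where a boundary term increases, its process reaches zero, and it does so at a point at which
the boundary term has already attained its terminal value. -/
lemma IsBoundaryTerm.exists_eq_zero {x ℓ : ℝ → ℝ} (h : IsBoundaryTerm x ℓ) (hx : Continuous x)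
    (hx0 : ∀ s, 0 ≤ s → 0 ≤ x s) {u v : ℝ} (hu : 0 ≤ u) (huv : u ≤ v) (hlt : ℓ u < ℓ v) :
    ∃ s ∈ Icc u v, x s = 0 ∧ ℓ s = ℓ v := by
  obtain ⟨hc, hm, -, hint⟩ := h
  have hcompact : IsCompact (Icc u v ∩ ℓ ⁻¹' {ℓ v}) :=
    isCompact_Icc.inter_right (isClosed_singleton.preimage hc)
  obtain ⟨s, ⟨hs, hsv⟩, hleast⟩ := hcompact.exists_isLeast ⟨v, ⟨huv, le_rfl⟩, rfl⟩
  have hsv : ℓ s = ℓ v := hsv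
  refine ⟨s, hs, ?_, hsv⟩
  by_contra hne
  have hpos : 0 < x s := lt_of_le_of_ne (hx0 s (hu.trans hs.1)) (Ne.symm hne)
  have hus : u < s := by
    refine lt_of_le_of_ne hs.1 ?_
    rintro rfl
    exact hlt.ne hsv
  have hnhds : {r | 0 < x r} ∈ nhds s := (isOpen_lt continuous_const hx).mem_nhds hpos
  obtain ⟨p, ⟨hup, hps⟩, hp⟩ := exists_Ioc_subset_of_mem_nhds' hnhds hus
  have hlp : ℓ p < ℓ s := by
    refine lt_of_le_of_ne (hm hps.le) fun heq => ?_
    exact hps.not_ge (hleast ⟨⟨hup, hps.le.trans hs.2⟩, heq.trans hsv⟩)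
  have hsub : Ioc p s ⊆ Ici (0 : ℝ) := fun r hr => (hu.trans hup).trans hr.1.le
  have hint' : ∫⁻ r in Ioc p s, ENNReal.ofReal (x r) ∂(lsMeasure ℓ) = 0 :=
    le_antisymm ((lintegral_mono_set hsub).trans hint.le) zero_le
  have hmeas : 0 < lsMeasure ℓ (Ioc p s) := by
    rw [lsMeasure_Ioc hm hc]
    exact ENNReal.ofReal_pos.2 (sub_pos.2 hlp)
  refine (setLIntegral_pos_iff hx.measurable.ennreal_ofReal |>.2 ?_).ne' hint'
  refine hmeas.trans_le (measure_mono fun r hr => ⟨?_, hr⟩)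
  exact (ENNReal.ofReal_pos.2 (hp hr)).ne'

lemma abs_sub_le_modCont {f : ℝ → ℝ} (hf : Continuous f) {t δ p q : ℝ} (hp : p ∈ Icc 0 t)
    (hq : q ∈ Icc 0 t) (hpq : |p - q| ≤ δ) : |f p - f q| ≤ modCont f t δ := by
  refine le_csSup ?_ ⟨(p, q), ⟨hp, hq, hpq⟩, rfl⟩
  have hc : Continuous fun p : ℝ × ℝ => |f p.1 - f p.2| := by fun_prop
  refine ((isCompact_Icc.prod isCompact_Icc).bddAbove_image (K := Icc 0 t ×ˢ Icc 0 t)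
    hc.continuousOn).mono (image_mono ?_)
  exact fun r hr => ⟨hr.1, hr.2.1⟩

lemma modCont_le_of_monotone {f : ℝ → ℝ} (hf : Monotone f) {t δ C : ℝ} (hδ : 0 ≤ δ) (ht : 0 ≤ t)
    (h : ∀ u v, 0 ≤ u → u ≤ v → v ≤ t → v - u ≤ δ → f v - f u ≤ C) : modCont f t δ ≤ C := by
  refine csSup_le ⟨_, (0, 0), ⟨⟨le_rfl, ht⟩, ⟨le_rfl, ht⟩, by simpa using hδ⟩, rfl⟩ ?_
  rintro _ ⟨⟨p, q⟩, ⟨hp, hq, hpq⟩, rfl⟩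
  dsimp only at hp hq hpq ⊢
  rcases le_total p q with hle | hle
  · rw [abs_sub_comm, abs_of_nonneg (sub_nonneg.2 (hf hle))]
    refine h p q hp.1 hle hq.2 ?_
    rw [abs_sub_comm] at hpq
    exact (le_abs_self _).trans hpq
  · rw [abs_of_nonneg (sub_nonneg.2 (hf hle))]
    exact h q p hq.1 hle hp.2 ((le_abs_self _).trans hpq)

/-- A vector dominated by `W` plus `b < 1` times its leave-one-out averages is bounded
explicitly in terms of `W`. -/
lemma le_of_le_add_mul_average_erase {n : ℕ} (hn : 2 ≤ n) {b : ℝ} (hb0 : 0 ≤ b) (hb1 : b < 1)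
    {D W : Fin n → ℝ} (hD : ∀ i, 0 ≤ D i)
    (h : ∀ i, D i ≤ W i + b * (((n : ℝ) - 1)⁻¹ * ∑ j ∈ Finset.univ.erase i, D j)) (i : Fin n) :
    D i ≤ W i + 2 * b * (1 - b)⁻¹ * ((n : ℝ)⁻¹ * ∑ j, W j) := by
  have hn' : (2 : ℝ) ≤ n := by exact_mod_cast hn
  have herase : ∀ i, ∑ j ∈ Finset.univ.erase i, D j = ∑ j, D j - D i := fun i => by
    rw [← Finset.add_sum_erase _ D (Finset.mem_univ i)]; ring
  have hsum : ∑ j, D j ≤ ∑ j, W j + b * ∑ j, D j := by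
    refine (Finset.sum_le_sum fun i _ => h i).trans_eq ?_
    rw [Finset.sum_add_distrib, ← Finset.mul_sum, ← Finset.mul_sum]
    simp only [herase, Finset.sum_sub_distrib, Finset.sum_const, Finset.card_univ,
      Fintype.card_fin, nsmul_eq_mul]
    have : (n : ℝ) - 1 ≠ 0 := by linarith
    field_simp
  have hsum' : ∑ j, D j ≤ (1 - b)⁻¹ * ∑ j, W j := by
    rw [inv_mul_eq_div, le_div_iff₀ (by linarith)]
    linarith
  have hinv : ((n : ℝ) - 1)⁻¹ ≤ 2 * (n : ℝ)⁻¹ := by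
    rw [← div_eq_mul_inv, inv_le_comm₀ (by linarith) (by positivity), inv_div]
    linarith
  have hnonneg : 0 ≤ ∑ j, D j := Finset.sum_nonneg fun j _ => hD j
  refine (h i).trans (add_le_add_right ?_ _)
  calc b * (((n : ℝ) - 1)⁻¹ * ∑ j ∈ Finset.univ.erase i, D j)
      ≤ b * ((2 * (n : ℝ)⁻¹) * ∑ j, D j) := by
        refine mul_le_mul_of_nonneg_left (mul_le_mul hinv ?_ ?_ (by positivity)) hb0
        · rw [herase]; linarith [hD i]
        · exact Finset.sum_nonneg fun j _ => hD j
    _ ≤ b * ((2 * (n : ℝ)⁻¹) * ((1 - b)⁻¹ * ∑ j, W j)) := by gcongr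
    _ = 2 * b * (1 - b)⁻¹ * ((n : ℝ)⁻¹ * ∑ j, W j) := by ring

lemma HomogeneousSystem.increment_le {n : ℕ} (hn : 2 ≤ n) {a : ℝ} (ha : a < 0)
    {x0 : Fin n → ℝ} {w x ℓ : Fin n → ℝ → ℝ} (hsys : HomogeneousSystem n a x0 w x ℓ) {t δ u v : ℝ}
    (hu : 0 ≤ u) (huv : u ≤ v) (hvt : v ≤ t) (hδ : v - u ≤ δ) (i : Fin n) :
    ℓ i v - ℓ i u ≤ modCont (w i) t δ +
      |a| * (((n : ℝ) - 1)⁻¹ * ∑ j ∈ Finset.univ.erase i, (ℓ j v - ℓ j u)) := by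
  obtain ⟨-, hw, -, hxc, hx0, hℓ, heq⟩ := hsys
  have hmono : ∀ j, Monotone (ℓ j) := fun j => (hℓ j).2.1
  have hn' : (0 : ℝ) ≤ (n : ℝ) - 1 := by
    have : (2 : ℝ) ≤ n := by exact_mod_cast hn
    linarith
  have huI : u ∈ Icc 0 t := ⟨hu, huv.trans hvt⟩
  rcases (hmono i huv).eq_or_lt with hz | hlt
  · rw [hz, sub_self]
    have hW : 0 ≤ modCont (w i) t δ :=
      (abs_nonneg _).trans (abs_sub_le_modCont (hw i) huI huI (by rw [sub_self, abs_zero]; linarith))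
    have hS : 0 ≤ ∑ j ∈ Finset.univ.erase i, (ℓ j v - ℓ j u) :=
      Finset.sum_nonneg fun j _ => sub_nonneg.2 (hmono j huv)
    positivity
  · obtain ⟨s, hs, hxs, hsv⟩ := (hℓ i).exists_eq_zero (hxc i) (hx0 i) hu huv hlt
    have hwb : |w i u - w i s| ≤ modCont (w i) t δ := by
      refine abs_sub_le_modCont (hw i) huI ⟨hu.trans hs.1, hs.2.trans hvt⟩ ?_
      rw [abs_sub_comm, abs_of_nonneg (sub_nonneg.2 hs.1)]
      linarith [hs.2]
    have hS : |a| * (((n : ℝ) - 1)⁻¹ * ∑ j ∈ Finset.univ.erase i, (ℓ j s - ℓ j u)) ≤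
        |a| * (((n : ℝ) - 1)⁻¹ * ∑ j ∈ Finset.univ.erase i, (ℓ j v - ℓ j u)) := by
      gcongr with j hj
      exact hmono j hs.2
    refine le_trans ?_ (add_le_add hwb hS)
    rw [abs_of_neg ha, Finset.sum_sub_distrib]
    have hes := heq i s (hu.trans hs.1)
    have heu := heq i u hu
    have hxu := hx0 i u hu
    linarith [le_abs_self (w i u - w i s)]

theorem stmt8 (n : ℕ) (hn : 2 ≤ n) (a : ℝ) (ha1 : -1 < a) (ha2 : a < 0)
    (x0 : Fin n → ℝ) (w x ℓ : Fin n → ℝ → ℝ)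
    (hsys : HomogeneousSystem n a x0 w x ℓ) :
    ∀ i t δ, 0 ≤ δ → δ ≤ t →
      modCont (ℓ i) t δ ≤ modCont (w i) t δ
        + 2 * |a| * (1 - |a|)⁻¹ * ((n : ℝ)⁻¹ * ∑ j, modCont (w j) t δ) := by
  intro i t δ hδ hδt
  have hmono : ∀ j, Monotone (ℓ j) := fun j => (hsys.2.2.2.2.2.1 j).2.1
  refine modCont_le_of_monotone (hmono i) hδ (hδ.trans hδt) fun u v hu huv hvt hvu => ?_
  exact le_of_le_add_mul_average_erase hn (abs_nonneg a) (abs_lt.2 ⟨ha1, ha2.trans one_pos⟩)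
    (D := fun j => ℓ j v - ℓ j u) (W := fun j => modCont (w j) t δ)
    (fun j => sub_nonneg.2 (hmono j huv)) (hsys.increment_le hn ha2 hu huv hvt hvu) i
end

section
/- Let a ∈ ℝ, n ≥ 2, ε > 0. Suppose y_i : [0,∞)→ℝ are continuous functions and x_{0,i} ≥ 0 are constants, w_i : [0,∞)→ℝ are continuous with w_i(0)=0, satisfying y_i(t) = x_{0,i} + w_i(t) + λ_i(t) + a⟨λ(t)⟩_i for all t ≥ 0 and all i, where λ_i(t) = ∫₀ᵗ 𝔭_ε(y_i(s)) ds and ⟨λ(t)⟩_i = (n−1)⁻¹∑_{j≠i} λ_j(t). Then for every i, every t ≥ 0 and every 0 ≤ δ ≤ t, w_t(λ_i, δ) ≤ sup_{s∈[0,t]} (y_i(s))⁻ + w_t(w_i, δ) + a⁻ ⟨w_t(λ, δ)⟩_i, where a⁻ = max(−a,0) and ⟨w_t(λ,δ)⟩_i = (n−1)⁻¹∑_{j≠i} w_t(λ_j, δ). -/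
open MeasureTheory Set

theorem penalty_eq_max_min {ε : ℝ} (hε : 0 < ε) (x : ℝ) :
    penalty ε x = max 0 (min ε⁻¹ (-(x / ε ^ 2))) := by
  have h2 : 0 < ε ^ 2 := by positivity
  have hi : 0 < ε⁻¹ := inv_pos.2 hε
  have he : ε⁻¹ = ε / ε ^ 2 := by field_simp
  unfold penalty
  split_ifs with h₁ h₂
  · have : ε⁻¹ ≤ -(x / ε ^ 2) := by
      rw [he, ← neg_div]
      gcongr
      linarith
    rw [min_eq_left this, max_eq_right hi.le]
  · have : -(x / ε ^ 2) ≤ ε⁻¹ := by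
      rw [he, ← neg_div]
      gcongr
      linarith
    have h0 : 0 ≤ -(x / ε ^ 2) := by
      rw [← neg_div]
      exact div_nonneg (by linarith) h2.le
    rw [min_eq_right this, max_eq_right h0]
  · have h0 : -(x / ε ^ 2) ≤ 0 := by
      rw [neg_nonpos]
      exact div_nonneg (by linarith) h2.le
    rw [max_eq_left ((min_le_right _ _).trans h0)]

theorem continuous_penalty {ε : ℝ} (hε : 0 < ε) : Continuous (penalty ε) := by
  rw [funext (penalty_eq_max_min hε)]
  fun_prop

theorem penalty_nonneg {ε : ℝ} (hε : 0 < ε) (x : ℝ) : 0 ≤ penalty ε x := by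
  rw [penalty_eq_max_min hε]
  exact le_max_left _ _

theorem penalty_of_nonneg {ε x : ℝ} (hε : 0 < ε) (hx : 0 ≤ x) : penalty ε x = 0 := by
  rw [penalty, if_neg (by linarith), if_neg (by linarith)]

theorem abs_sub_le_modCont_s14 {f : ℝ → ℝ} (hf : Continuous f) {t δ s u : ℝ}
    (hs : s ∈ Icc 0 t) (hu : u ∈ Icc 0 t) (h : |s - u| ≤ δ) :
    |f s - f u| ≤ modCont f t δ := by
  refine le_csSup ?_ ⟨(s, u), ⟨hs, hu, h⟩, rfl⟩
  obtain ⟨C, hC⟩ := (isCompact_Icc (a := (0 : ℝ)) (b := t)).exists_bound_of_continuousOn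
    hf.continuousOn
  refine ⟨C + C, ?_⟩
  rintro _ ⟨p, ⟨h₁, h₂, -⟩, rfl⟩
  exact (abs_sub _ _).trans (add_le_add (hC _ h₁) (hC _ h₂))

theorem modCont_nonneg (f : ℝ → ℝ) (t δ : ℝ) : 0 ≤ modCont f t δ := by
  apply Real.sSup_nonneg
  rintro _ ⟨p, -, rfl⟩
  exact abs_nonneg _

theorem nnegPart_nonneg (r : ℝ) : 0 ≤ nnegPart r := le_max_right _ _

theorem neg_le_nnegPart (r : ℝ) : -r ≤ nnegPart r := le_max_left _ _

theorem nnegPart_le_sSup {f : ℝ → ℝ} (hf : Continuous f) {t s : ℝ} (hs : s ∈ Icc 0 t) :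
    nnegPart (f s) ≤ sSup ((fun s => nnegPart (f s)) '' Icc 0 t) := by
  have hc : Continuous fun s => nnegPart (f s) := by
    unfold nnegPart
    fun_prop
  exact le_csSup (isCompact_Icc.image hc).bddAbove ⟨s, hs, rfl⟩

/-- On an interval, the penalty integral of `f` either vanishes or is accumulated before the
last time at which `f` is nonpositive. -/
theorem integral_penalty_eq_zero_or_exists {ε : ℝ} (hε : 0 < ε) {f : ℝ → ℝ} (hf : Continuous f)
    {s u : ℝ} (hsu : s ≤ u) :
    (∫ v in s..u, penalty ε (f v)) = 0 ∨
      ∃ r ∈ Icc s u, f r ≤ 0 ∧ (∫ v in r..u, penalty ε (f v)) = 0 := by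
  have key : ∀ r ≤ u, (∀ v ∈ Ioc r u, 0 ≤ f v) → (∫ v in r..u, penalty ε (f v)) = 0 := by
    intro r hr h
    rw [intervalIntegral.integral_of_le hr]
    exact setIntegral_eq_zero_of_forall_eq_zero fun v hv => penalty_of_nonneg hε (h v hv)
  rcases (Icc s u ∩ f ⁻¹' Iic 0).eq_empty_or_nonempty with he | hne
  · refine Or.inl (key s hsu fun v hv => ?_)
    by_contra! hlt
    exact (he.le ⟨Ioc_subset_Icc_self hv, hlt.le⟩ : v ∈ (∅ : Set ℝ))
  · obtain ⟨r, ⟨hr, hfr⟩, hmax⟩ :=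
      (isCompact_Icc.inter_right (isClosed_Iic.preimage hf)).exists_isGreatest hne
    refine Or.inr ⟨r, hr, hfr, key r hr.2 fun v hv => ?_⟩
    by_contra! hlt
    exact absurd (hmax ⟨⟨hr.1.trans hv.1.le, hv.2⟩, hlt.le⟩) (not_le.2 hv.1)

theorem stmt14 (a : ℝ) (n : ℕ) (hn : 2 ≤ n) (ε : ℝ) (hε : 0 < ε)
    (x0 : Fin n → ℝ) (hx0 : ∀ i, 0 ≤ x0 i)
    (w : Fin n → ℝ → ℝ) (hw : ∀ i, Continuous (w i)) (hw0 : ∀ i, w i 0 = 0)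
    (y lam : Fin n → ℝ → ℝ)
    (hy : ∀ i, Continuous (y i))
    (hlam : ∀ i t, lam i t = ∫ s in (0:ℝ)..t, penalty ε (y i s))
    (heq : ∀ i t, 0 ≤ t → y i t = x0 i + w i t + lam i t
        + a * (((n : ℝ) - 1)⁻¹ * ∑ j ∈ Finset.univ.erase i, lam j t)) :
    ∀ i t δ, 0 ≤ δ → δ ≤ t →
      modCont (lam i) t δ
        ≤ sSup ((fun s => nnegPart (y i s)) '' Set.Icc 0 t)
          + modCont (w i) t δ
          + nnegPart a * (((n : ℝ) - 1)⁻¹ * ∑ j ∈ Finset.univ.erase i, modCont (lam j) t δ) := by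
  intro i t δ hδ hδt
  have hpc : ∀ j, Continuous fun s => penalty ε (y j s) :=
    fun j => (continuous_penalty hε).comp (hy j)
  have hint : ∀ j p q, IntervalIntegrable (fun s => penalty ε (y j s)) volume p q :=
    fun j p q => (hpc j).intervalIntegrable p q
  have hsub : ∀ j p q, lam j q - lam j p = ∫ s in p..q, penalty ε (y j s) := by
    intro j p q
    rw [hlam, hlam, intervalIntegral.integral_interval_sub_left (hint j _ _) (hint j _ _)]
  have hlc : ∀ j, Continuous (lam j) := by
    intro j
    rw [funext (hlam j)]
    exact intervalIntegral.continuous_primitive (hint j) 0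
  have hmono : ∀ j p q, p ≤ q → lam j p ≤ lam j q := by
    intro j p q hpq
    rw [← sub_nonneg, hsub]
    exact intervalIntegral.integral_nonneg hpq fun _ _ => penalty_nonneg hε _
  have hn' : (0 : ℝ) ≤ ((n : ℝ) - 1)⁻¹ := by
    have : (2 : ℝ) ≤ n := by exact_mod_cast hn
    exact inv_nonneg.2 (by linarith)
  set S := sSup ((fun s => nnegPart (y i s)) '' Set.Icc 0 t)
  set M := ((n : ℝ) - 1)⁻¹ * ∑ j ∈ Finset.univ.erase i, modCont (lam j) t δ
  have hS : 0 ≤ S := (nnegPart_nonneg _).trans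
    (nnegPart_le_sSup (hy i) ⟨le_rfl, hδ.trans hδt⟩)
  have hM0 : 0 ≤ M := mul_nonneg hn' (Finset.sum_nonneg fun j _ => modCont_nonneg _ _ _)
  have hrhs : 0 ≤ S + modCont (w i) t δ + nnegPart a * M :=
    add_nonneg (add_nonneg hS (modCont_nonneg _ _ _)) (mul_nonneg (nnegPart_nonneg a) hM0)
  have main : ∀ s u, 0 ≤ s → s ≤ u → u ≤ t → u - s ≤ δ →
      lam i u - lam i s ≤ S + modCont (w i) t δ + nnegPart a * M := by
    intro s u hs hsu hut hd
    rcases integral_penalty_eq_zero_or_exists hε (hy i) hsu with h0 | ⟨r, ⟨hsr, hru⟩, hyr, h0⟩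
    · rwa [hsub, h0]
    · rw [← hsub] at h0
      have hsI : s ∈ Icc 0 t := ⟨hs, hsu.trans hut⟩
      have hrI : r ∈ Icc 0 t := ⟨hs.trans hsr, hru.trans hut⟩
      have hrs : |s - r| ≤ δ := by
        rw [abs_sub_comm, abs_of_nonneg (by linarith)]
        linarith
      have hys := (neg_le_nnegPart _).trans (nnegPart_le_sSup (hy i) hsI)
      have hws := (le_abs_self _).trans (abs_sub_le_modCont_s14 (hw i) hsI hrI hrs)
      set D := ((n : ℝ) - 1)⁻¹ * ∑ j ∈ Finset.univ.erase i, (lam j r - lam j s) with hD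
      have hD0 : 0 ≤ D :=
        mul_nonneg hn' (Finset.sum_nonneg fun j _ => sub_nonneg.2 (hmono j s r hsr))
      have hDM : D ≤ M := by
        refine mul_le_mul_of_nonneg_left (Finset.sum_le_sum fun j _ => ?_) hn'
        refine (le_abs_self _).trans ?_
        rw [abs_sub_comm]
        exact abs_sub_le_modCont_s14 (hlc j) hsI hrI hrs
      have haD : -a * D ≤ nnegPart a * M :=
        (mul_le_mul_of_nonneg_right (neg_le_nnegPart a) hD0).trans
          (mul_le_mul_of_nonneg_left hDM (nnegPart_nonneg a))
      have e₁ := heq i s hs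
      have e₂ := heq i r hrI.1
      rw [Finset.sum_sub_distrib, mul_sub] at hD
      rw [hD] at haD
      linarith
  refine Real.sSup_le ?_ hrhs
  rintro _ ⟨⟨p, q⟩, ⟨hp, hq, hpq⟩, rfl⟩
  obtain ⟨h₁, h₂⟩ := abs_le.1 hpq
  dsimp only at *
  rcases le_total p q with h | h
  · rw [abs_sub_comm, abs_of_nonneg (sub_nonneg.2 (hmono i p q h))]
    exact main p q hp.1 h hq.2 (by linarith)
  · rw [abs_of_nonneg (sub_nonneg.2 (hmono i q p h))]
    exact main q p hq.1 h hp.2 (by linarith)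
end
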